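/- Let Ω ⊆ ℝ³ be a domain convex in the direction of the line L₂ and assume that at least one number in each of the pairs (a₁, b₁) and (a₂, b₂) lies in ℂ∖ℝ. Then every right-G-monogenic mapping Φ₁₀ : Ω_ζ → 𝓘₁ has the form Φ₁₀(ζ) = F₁₂(ξ₂)e₂ + F₁₄(ξ₂)e₄ for all ζ = x i₁ + y i₂ + z i₃ ∈ Ω_ζ, and every left-G-monogenic mapping Φ̂₁₀ : Ω_ζ → 𝓘̂₁ has the form Φ̂₁₀(ζ) = F₁₁(ξ₂)e₂ + F₁₃(ξ₂)e₃, where F₁₂, F₁₄, F₁₁, F₁₃ are analytic functions on D₂ of the complex variable ξ₂ = x + y a₂ + z b₂. -/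

import Mathlib

open Filter Set Topology Quaternion

noncomputable section

abbrev HC : Type := ℍ[ℂ, -1, -1]

/-- The idempotent `e₁ = (1 + iI)/2`. -/
def e1 : HC := ⟨1/2, Complex.I/2, 0, 0⟩
/-- The idempotent `e₂ = (1 - iI)/2`. -/
def e2 : HC := ⟨1/2, -(Complex.I/2), 0, 0⟩
/-- `e₃ = (iJ - K)/2`. -/
def e3 : HC := ⟨0, 0, Complex.I/2, -(1/2)⟩
/-- `e₄ = (iJ + K)/2`. -/
def e4 : HC := ⟨0, 0, Complex.I/2, 1/2⟩

/-- Topology on `ℍ(ℂ)` induced from the four complex coordinates. -/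
instance : TopologicalSpace HC :=
  TopologicalSpace.induced (fun q : HC => (q.re, q.imI, q.imJ, q.imK)) inferInstance

/-- Coordinate of `a ∈ ℍ(ℂ)` at `e₁` in the basis `{e₁, e₂, e₃, e₄}`. -/
def c1 (a : HC) : ℂ := a.re - Complex.I * a.imI
/-- Coordinate at `e₂`. -/
def c2 (a : HC) : ℂ := a.re + Complex.I * a.imI
/-- Coordinate at `e₃`. -/
def c3 (a : HC) : ℂ := -(Complex.I * a.imJ) - a.imK
/-- Coordinate at `e₄`. -/
def c4 (a : HC) : ℂ := -(Complex.I * a.imJ) + a.imK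

/-- The norm `‖a‖ = √(|a₁|² + |a₂|² + |a₃|² + |a₄|²)`, coordinates in the basis `{e₁,e₂,e₃,e₄}`. -/
def qnorm (a : HC) : ℝ :=
  Real.sqrt (‖c1 a‖ ^ 2 + ‖c2 a‖ ^ 2 +
    ‖c3 a‖ ^ 2 + ‖c4 a‖ ^ 2)

/-- `f₁ : ℍ(ℂ) → ℂ`, the ℂ-linear functional with `f₁(e₁) = f₁(e₃) = 1`, `f₁(e₂) = f₁(e₄) = 0`. -/
def f1 (a : HC) : ℂ := c1 a + c3 a
/-- `f₂ : ℍ(ℂ) → ℂ`, with `f₂(e₂) = f₂(e₄) = 1`, `f₂(e₁) = f₂(e₃) = 0`. -/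
def f2 (a : HC) : ℂ := c2 a + c4 a
/-- `f̂₁ : ℍ(ℂ) → ℂ`, with `f̂₁(e₁) = f̂₁(e₄) = 1`, `f̂₁(e₂) = f̂₁(e₃) = 0`. -/
def fh1 (a : HC) : ℂ := c1 a + c4 a
/-- `f̂₂ : ℍ(ℂ) → ℂ`, with `f̂₂(e₂) = f̂₂(e₃) = 1`, `f̂₂(e₁) = f̂₂(e₄) = 0`. -/
def fh2 (a : HC) : ℂ := c2 a + c3 a

/-- `ζ = x i₁ + y i₂ + z i₃` for `p = (x, y, z) ∈ ℝ³` (with `i₁ = 1`). -/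
def zeta (i2 i3 : HC) (p : ℝ × ℝ × ℝ) : HC :=
  (p.1 : ℂ) • (1 : HC) + (p.2.1 : ℂ) • i2 + (p.2.2 : ℂ) • i3

/-- The real linear span `E₃` of `i₁ = 1, i₂, i₃`. -/
def E3 (i2 i3 : HC) : Set HC := Set.range (zeta i2 i3)

/-- `i₁ = 1, i₂, i₃` are linearly independent over `ℝ`. -/
def LinIndep (i2 i3 : HC) : Prop :=
  ∀ α₁ α₂ α₃ : ℝ, (α₁ : ℂ) • (1 : HC) + (α₂ : ℂ) • i2 + (α₃ : ℂ) • i3 = 0 →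
    α₁ = 0 ∧ α₂ = 0 ∧ α₃ = 0

/-- `Φ` is right-G-monogenic on `S` (w.r.t. directions in `E₃`): it is continuous on `S` and at
every `ζ ∈ S` there is `Φ'(ζ)` with `lim_{ε→0+} (Φ(ζ+εh) − Φ(ζ))ε⁻¹ = h·Φ'(ζ)` for all `h ∈ E₃`. -/
def RightGMonogenic (i2 i3 : HC) (Φ : HC → HC) (S : Set HC) : Prop :=
  ContinuousOn Φ S ∧ ∀ ζ ∈ S, ∃ Φ' : HC, ∀ h ∈ E3 i2 i3,
    Tendsto (fun ε : ℝ => ((ε : ℂ))⁻¹ • (Φ (ζ + (ε : ℂ) • h) - Φ ζ))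
      (nhdsWithin 0 (Set.Ioi 0)) (nhds (h * Φ'))

/-- `Φ̂` is left-G-monogenic on `S`. -/
def LeftGMonogenic (i2 i3 : HC) (Φ : HC → HC) (S : Set HC) : Prop :=
  ContinuousOn Φ S ∧ ∀ ζ ∈ S, ∃ Φ' : HC, ∀ h ∈ E3 i2 i3,
    Tendsto (fun ε : ℝ => ((ε : ℂ))⁻¹ • (Φ (ζ + (ε : ℂ) • h) - Φ ζ))
      (nhdsWithin 0 (Set.Ioi 0)) (nhds (Φ' * h))

/-- The right maximal ideal `𝓘₁ = {λ₂e₂ + λ₄e₄}`. -/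
def I1 : Set HC := {a | ∃ l2 l4 : ℂ, a = l2 • e2 + l4 • e4}
/-- The right maximal ideal `𝓘₂ = {λ₁e₁ + λ₃e₃}`. -/
def I2 : Set HC := {a | ∃ l1 l3 : ℂ, a = l1 • e1 + l3 • e3}
/-- The left maximal ideal `𝓘̂₁ = {λ₂e₂ + λ₃e₃}`. -/
def Ih1 : Set HC := {a | ∃ l2 l3 : ℂ, a = l2 • e2 + l3 • e3}
/-- The left maximal ideal `𝓘̂₂ = {λ₁e₁ + λ₄e₄}`. -/
def Ih2 : Set HC := {a | ∃ l1 l4 : ℂ, a = l1 • e1 + l4 • e4}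

/-- The line `L` in `ℝ³` given by `x + y·Re a + z·Re b = 0`, `y·Im a + z·Im b = 0`. -/
def lineL (a b : ℂ) : Set (ℝ × ℝ × ℝ) :=
  {p | p.1 + p.2.1 * a.re + p.2.2 * b.re = 0 ∧ p.2.1 * a.im + p.2.2 * b.im = 0}

/-- `Ω` is convex in the direction of the line `L` (a line through the origin): it contains every
segment parallel to `L` joining two of its points. -/
def ConvexInDirection (Ω : Set (ℝ × ℝ × ℝ)) (L : Set (ℝ × ℝ × ℝ)) : Prop :=
  ∀ p ∈ Ω, ∀ q ∈ Ω, q - p ∈ L → segment ℝ p q ⊆ Ω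

/-- `ξ = x + y·a + z·b` for `p = (x,y,z)`. -/
def xi (a b : ℂ) (p : ℝ × ℝ × ℝ) : ℂ := (p.1 : ℂ) + (p.2.1 : ℂ) * a + (p.2.2 : ℂ) * b


/-- `Φ'` is a right Gateaux derivative of `Φ` on `S` (directions in `E₃`). -/
def IsRightGDeriv (i2 i3 : HC) (Φ Φ' : HC → HC) (S : Set HC) : Prop :=
  ∀ ζ ∈ S, ∀ h ∈ E3 i2 i3,
    Tendsto (fun ε : ℝ => ((ε : ℂ))⁻¹ • (Φ (ζ + (ε : ℂ) • h) - Φ ζ))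
      (nhdsWithin 0 (Set.Ioi 0)) (nhds (h * Φ' ζ))

/-- `Φ'` is a left Gateaux derivative of `Φ` on `S`. -/
def IsLeftGDeriv (i2 i3 : HC) (Φ Φ' : HC → HC) (S : Set HC) : Prop :=
  ∀ ζ ∈ S, ∀ h ∈ E3 i2 i3,
    Tendsto (fun ε : ℝ => ((ε : ℂ))⁻¹ • (Φ (ζ + (ε : ℂ) • h) - Φ ζ))
      (nhdsWithin 0 (Set.Ioi 0)) (nhds (Φ' ζ * h))

/-- Triples `(α, β, γ)` of naturals with `α + β + γ = n`. -/
def trip (n : ℕ) : Finset (ℕ × ℕ × ℕ) :=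
  (Finset.range (n + 1) ×ˢ Finset.range (n + 1) ×ˢ Finset.range (n + 1)).filter
    (fun u => u.1 + u.2.1 + u.2.2 = n)

/-! ### A Looman-Menchoff type theorem -/

/-- Boundary integral over a rectangle. -/
def rI (F : ℂ → ℂ) (x0 x1 y0 y1 : ℝ) : ℂ :=
  (∫ x : ℝ in x0..x1, F (x + y0 * Complex.I)) - (∫ x : ℝ in x0..x1, F (x + y1 * Complex.I)) +
    Complex.I • (∫ y : ℝ in y0..y1, F (x1 + y * Complex.I)) -
    Complex.I • (∫ y : ℝ in y0..y1, F (x0 + y * Complex.I))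

lemma rI_addx {F : ℂ → ℂ} (hF : Continuous F) (x0 x1 x2 y0 y1 : ℝ) :
    rI F x0 x2 y0 y1 = rI F x0 x1 y0 y1 + rI F x1 x2 y0 y1 := by
  have h : ∀ y : ℝ, (∫ x : ℝ in x0..x2, F (x + y * Complex.I)) =
      (∫ x : ℝ in x0..x1, F (x + y * Complex.I)) + ∫ x : ℝ in x1..x2, F (x + y * Complex.I) := by
    intro y
    rw [intervalIntegral.integral_add_adjacent_intervals] <;>
      exact Continuous.intervalIntegrable (by fun_prop) _ _
  unfold rI
  rw [h, h]
  ring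

lemma rI_addy {F : ℂ → ℂ} (hF : Continuous F) (x0 x1 y0 y1 y2 : ℝ) :
    rI F x0 x1 y0 y2 = rI F x0 x1 y0 y1 + rI F x0 x1 y1 y2 := by
  have h : ∀ x : ℝ, (∫ y : ℝ in y0..y2, F (x + y * Complex.I)) =
      (∫ y : ℝ in y0..y1, F (x + y * Complex.I)) + ∫ y : ℝ in y1..y2, F (x + y * Complex.I) := by
    intro y
    rw [intervalIntegral.integral_add_adjacent_intervals] <;>
      exact Continuous.intervalIntegrable (by fun_prop) _ _
  unfold rI
  rw [h, h]
  simp only [smul_add]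
  ring

lemma rI_sub_affine {F : ℂ → ℂ} (hF : Continuous F) (c e : ℂ) (x0 x1 y0 y1 : ℝ) :
    rI (fun z => F z - (c * z + e)) x0 x1 y0 y1 = rI F x0 x1 y0 y1 := by
  have h1 : rI (fun z => c * z + e) x0 x1 y0 y1 = 0 := by
    have := Complex.integral_boundary_rect_eq_zero_of_differentiableOn (fun z => c * z + e)
      (⟨x0, y0⟩ : ℂ) (⟨x1, y1⟩ : ℂ) (by fun_prop)
    exact this
  have h2 : rI (fun z => F z - (c * z + e)) x0 x1 y0 y1 =
      rI F x0 x1 y0 y1 - rI (fun z => c * z + e) x0 x1 y0 y1 := by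
    unfold rI
    simp only []
    rw [intervalIntegral.integral_sub, intervalIntegral.integral_sub,
      intervalIntegral.integral_sub, intervalIntegral.integral_sub]
    · simp only [smul_sub]; ring
    all_goals exact Continuous.intervalIntegrable (by fun_prop) _ _
  rw [h2, h1, sub_zero]

lemma rI_norm_le {F : ℂ → ℂ} {x0 x1 y0 y1 B L : ℝ} (hx : x0 ≤ x1) (hy : y0 ≤ y1)
    (hxL : x1 - x0 ≤ L) (hyL : y1 - y0 ≤ L) (hB : 0 ≤ B)
    (h : ∀ q ∈ Icc x0 x1 ×ℂ Icc y0 y1,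
      (q.re = x0 ∨ q.re = x1 ∨ q.im = y0 ∨ q.im = y1) → ‖F q‖ ≤ B) :
    ‖rI F x0 x1 y0 y1‖ ≤ 4 * B * L := by
  have hh : ∀ y, y = y0 ∨ y = y1 → ‖∫ x : ℝ in x0..x1, F (x + y * Complex.I)‖ ≤ B * L := by
    intro y hyy
    refine (intervalIntegral.norm_integral_le_of_norm_le_const (C := B) ?_).trans ?_
    · intro x hxx
      rw [uIoc_of_le hx] at hxx
      apply h
      · simp [Complex.mem_reProdIm]
        refine ⟨⟨hxx.1.le, hxx.2⟩, ?_⟩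
        rcases hyy with rfl | rfl <;> simp [hy]
      · simp; tauto
    · rw [abs_of_nonneg (by linarith)]; gcongr
  have hv : ∀ x, x = x0 ∨ x = x1 → ‖∫ y : ℝ in y0..y1, F (x + y * Complex.I)‖ ≤ B * L := by
    intro y hyy
    refine (intervalIntegral.norm_integral_le_of_norm_le_const (C := B) ?_).trans ?_
    · intro x hxx
      rw [uIoc_of_le hy] at hxx
      apply h
      · simp [Complex.mem_reProdIm]
        refine ⟨?_, ⟨hxx.1.le, hxx.2⟩⟩
        rcases hyy with rfl | rfl <;> simp [hx]
      · simp; tauto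
    · rw [abs_of_nonneg (by linarith)]; gcongr
  unfold rI
  refine (norm_sub_le _ _).trans ?_
  have h1 := norm_add_le ((∫ x : ℝ in x0..x1, F (x + y0 * Complex.I)) -
    (∫ x : ℝ in x0..x1, F (x + y1 * Complex.I)))
    (Complex.I • (∫ y : ℝ in y0..y1, F (x1 + y * Complex.I)))
  have h2 := norm_sub_le (∫ x : ℝ in x0..x1, F (x + y0 * Complex.I))
    (∫ x : ℝ in x0..x1, F (x + y1 * Complex.I))
  rw [norm_smul, Complex.norm_I, one_mul] at *
  have := hh y0 (Or.inl rfl)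
  have := hh y1 (Or.inr rfl)
  have := hv x0 (Or.inl rfl)
  have := hv x1 (Or.inr rfl)
  linarith

/-- Additive nonnegative rectangle functions. -/
structure AddRect (κ : ℝ → ℝ → ℝ → ℝ → ℝ) : Prop where
  nonneg : ∀ x0 x1 y0 y1, 0 ≤ κ x0 x1 y0 y1
  addx : ∀ x0 x1 x2 y0 y1, x0 ≤ x1 → x1 ≤ x2 → κ x0 x2 y0 y1 = κ x0 x1 y0 y1 + κ x1 x2 y0 y1
  addy : ∀ x0 x1 y0 y1 y2, y0 ≤ y1 → y1 ≤ y2 → κ x0 x1 y0 y2 = κ x0 x1 y0 y1 + κ x0 x1 y1 y2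

/-- `c` times the area of `E` in a rectangle. -/
def kap (c : ℝ) (E : Set ℂ) (x0 x1 y0 y1 : ℝ) : ℝ :=
  c * MeasureTheory.volume.real (E ∩ (Ioc x0 x1 ×ℂ Ioc y0 y1))

lemma vol_rect_ne_top (E : Set ℂ) (x0 x1 y0 y1 : ℝ) :
    MeasureTheory.volume (E ∩ (Ioc x0 x1 ×ℂ Ioc y0 y1)) ≠ ⊤ := by
  have : Bornology.IsBounded (Ioc x0 x1 ×ℂ Ioc y0 y1) :=
    (Metric.isBounded_Ioc _ _).reProdIm (Metric.isBounded_Ioc _ _)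
  exact ((this.subset inter_subset_right).measure_lt_top).ne

lemma addRect_kap {c : ℝ} (hc : 0 ≤ c) (E : Set ℂ) :
    AddRect (kap c E) := by
  refine ⟨fun _ _ _ _ => mul_nonneg hc MeasureTheory.measureReal_nonneg, ?_, ?_⟩
  · intro x0 x1 x2 y0 y1 h1 h2
    have hm : MeasurableSet {z : ℂ | z.re ≤ x1} :=
      measurableSet_le Complex.measurable_re measurable_const
    have := MeasureTheory.measureReal_inter_add_sdiff (μ := MeasureTheory.volume)
      (s := E ∩ (Ioc x0 x2 ×ℂ Ioc y0 y1)) hm (vol_rect_ne_top _ _ _ _ _)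
    unfold kap
    rw [← this, mul_add]
    congr 3
    · ext z
      simp only [mem_inter_iff, Complex.mem_reProdIm, mem_Ioc, mem_ofPred_eq]
      constructor
      · rintro ⟨⟨a, ⟨b, c⟩, d⟩, e⟩; exact ⟨a, ⟨b, e⟩, d⟩
      · rintro ⟨a, ⟨b, c⟩, d⟩; exact ⟨⟨a, ⟨b, c.trans h2⟩, d⟩, c⟩
    · ext z
      simp only [mem_inter_iff, Complex.mem_reProdIm, mem_Ioc, mem_ofPred_eq, Set.mem_sdiff, not_le]
      constructor
      · rintro ⟨⟨a, ⟨b, c⟩, d⟩, e⟩; exact ⟨a, ⟨e, c⟩, d⟩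
      · rintro ⟨a, ⟨b, c⟩, d⟩; exact ⟨⟨a, ⟨h1.trans_lt b, c⟩, d⟩, b⟩
  · intro x0 x1 y0 y1 y2 h1 h2
    have hm : MeasurableSet {z : ℂ | z.im ≤ y1} :=
      measurableSet_le Complex.measurable_im measurable_const
    have := MeasureTheory.measureReal_inter_add_sdiff (μ := MeasureTheory.volume)
      (s := E ∩ (Ioc x0 x1 ×ℂ Ioc y0 y2)) hm (vol_rect_ne_top _ _ _ _ _)
    unfold kap
    rw [← this, mul_add]
    congr 3
    · ext z
      simp only [mem_inter_iff, Complex.mem_reProdIm, mem_Ioc, mem_ofPred_eq]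
      constructor
      · rintro ⟨⟨a, d, ⟨b, c⟩⟩, e⟩; exact ⟨a, d, ⟨b, e⟩⟩
      · rintro ⟨a, d, ⟨b, c⟩⟩; exact ⟨⟨a, d, ⟨b, c.trans h2⟩⟩, c⟩
    · ext z
      simp only [mem_inter_iff, Complex.mem_reProdIm, mem_Ioc, mem_ofPred_eq, Set.mem_sdiff, not_le]
      constructor
      · rintro ⟨⟨a, d, ⟨b, c⟩⟩, e⟩; exact ⟨a, d, ⟨e, c⟩⟩
      · rintro ⟨a, d, ⟨b, c⟩⟩; exact ⟨⟨a, d, ⟨h1.trans_lt b, c⟩⟩, b⟩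

lemma vol_rect {x0 x1 y0 y1 : ℝ} (hx : x0 ≤ x1) (hy : y0 ≤ y1) :
    MeasureTheory.volume.real (Ioc x0 x1 ×ℂ Ioc y0 y1) = (x1 - x0) * (y1 - y0) := by
  have h : (Ioc x0 x1 ×ℂ Ioc y0 y1) =
      Complex.measurableEquivRealProd ⁻¹' (Ioc x0 x1 ×ˢ Ioc y0 y1) := by
    ext z; simp [Complex.mem_reProdIm]
  rw [h, MeasureTheory.measureReal_def,
    Complex.volume_preserving_equiv_real_prod.measure_preimage_equiv,
    MeasureTheory.Measure.volume_eq_prod, MeasureTheory.Measure.prod_prod]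
  simp [hx, hy]

/-- Bounding box estimate. -/
lemma bb {F : ℂ → ℂ} (hF : Continuous F) {A : Set ℂ} (hA : IsClosed A)
    {κ : ℝ → ℝ → ℝ → ℝ → ℝ} (hκ : AddRect κ) {x0 x1 y0 y1 : ℝ}
    {L B : ℝ} (hxL : x1 - x0 ≤ L) (hyL : y1 - y0 ≤ L)
    (hB : 0 ≤ B)
    (h0 : ∀ u0 u1 v0 v1, x0 ≤ u0 → u0 ≤ u1 → u1 ≤ x1 → y0 ≤ v0 → v0 ≤ v1 → v1 ≤ y1 →
      Disjoint (Ioo u0 u1 ×ℂ Ioo v0 v1) A → ‖rI F u0 u1 v0 v1‖ ≤ κ u0 u1 v0 v1)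
    (hM : ∀ p ∈ A, p ∈ Icc x0 x1 ×ℂ Icc y0 y1 → ∀ q ∈ Icc x0 x1 ×ℂ Icc y0 y1,
      (q.re = p.re ∨ q.im = p.im) → ‖F q - F p‖ ≤ B)
    (hne : (A ∩ (Icc x0 x1 ×ℂ Icc y0 y1)).Nonempty) :
    ‖rI F x0 x1 y0 y1‖ ≤ κ x0 x1 y0 y1 + 12 * B * L := by
  have hcomp : IsCompact (A ∩ (Icc x0 x1 ×ℂ Icc y0 y1)) :=
    (isCompact_Icc.reProdIm isCompact_Icc).inter_left hA
  obtain ⟨pl, hpl, hl⟩ := hcomp.exists_isMinOn hne Complex.continuous_re.continuousOn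
  obtain ⟨pr, hpr, hr⟩ := hcomp.exists_isMaxOn hne Complex.continuous_re.continuousOn
  obtain ⟨pb, hpb, hb⟩ := hcomp.exists_isMinOn hne Complex.continuous_im.continuousOn
  obtain ⟨pt, hpt, ht⟩ := hcomp.exists_isMaxOn hne Complex.continuous_im.continuousOn
  rw [isMinOn_iff] at hl hb
  rw [isMaxOn_iff] at hr ht
  have hlr := hl pr hpr
  have hbt := hb pt hpt
  have hlb := hl pb hpb
  have hlt := hl pt hpt
  have hrb := hr pb hpb
  have hrt := hr pt hpt
  have hbl := hb pl hpl
  have hbr := hb pr hpr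
  have htl := ht pl hpl
  have htr := ht pr hpr
  obtain ⟨hplA, hplR⟩ := id hpl
  obtain ⟨hprA, hprR⟩ := id hpr
  obtain ⟨hpbA, hpbR⟩ := id hpb
  obtain ⟨hptA, hptR⟩ := id hpt
  obtain ⟨⟨l1, l2⟩, ⟨l3, l4⟩⟩ := hplR
  obtain ⟨⟨r1, r2⟩, ⟨r3, r4⟩⟩ := hprR
  obtain ⟨⟨b1, b2⟩, ⟨b3, b4⟩⟩ := hpbR
  obtain ⟨⟨t1, t2⟩, ⟨t3, t4⟩⟩ := hptR
  -- Lipschitz between points of A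
  have hAA : ∀ p ∈ A ∩ (Icc x0 x1 ×ℂ Icc y0 y1), ∀ p' ∈ A ∩ (Icc x0 x1 ×ℂ Icc y0 y1),
      ‖F p - F p'‖ ≤ 2 * B := by
    intro p hp p' hp'
    have hc : (⟨p.re, p'.im⟩ : ℂ) ∈ Icc x0 x1 ×ℂ Icc y0 y1 := ⟨hp.2.1, hp'.2.2⟩
    have h1 := hM p hp.1 hp.2 _ hc (Or.inl rfl)
    have h2 := hM p' hp'.1 hp'.2 _ hc (Or.inr rfl)
    calc ‖F p - F p'‖ = ‖(F ⟨p.re, p'.im⟩ - F p') - (F ⟨p.re, p'.im⟩ - F p)‖ := by congr 1; ring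
      _ ≤ _ := norm_sub_le _ _
      _ ≤ 2 * B := by linarith
  have hinner : ‖rI F pl.re pr.re pb.im pt.im‖ ≤ 12 * B * L := by
    rw [← rI_sub_affine hF 0 (F pl)]
    have : 12 * B * L = 4 * (3 * B) * L := by ring
    rw [this]
    apply rI_norm_le hlr hbt (by linarith) (by linarith) (by linarith)
    intro q hq hq'
    obtain ⟨⟨q1, q2⟩, ⟨q3, q4⟩⟩ := hq
    have hqR : q ∈ Icc x0 x1 ×ℂ Icc y0 y1 :=
      ⟨⟨by linarith, by linarith⟩, ⟨by linarith, by linarith⟩⟩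
    have key : ∃ p ∈ A ∩ (Icc x0 x1 ×ℂ Icc y0 y1), q.re = p.re ∨ q.im = p.im := by
      rcases hq' with h | h | h | h
      exacts [⟨pl, hpl, Or.inl h⟩, ⟨pr, hpr, Or.inl h⟩, ⟨pb, hpb, Or.inr h⟩, ⟨pt, hpt, Or.inr h⟩]
    obtain ⟨p, hp, hpq⟩ := key
    have h1 := hM p hp.1 hp.2 q hqR hpq
    have h2 := hAA p hp pl hpl
    calc ‖F q - (0 * q + F pl)‖ = ‖(F q - F p) + (F p - F pl)‖ := by congr 1; ring
      _ ≤ _ := norm_add_le _ _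
      _ ≤ 3 * B := by linarith
  have hdis : ∀ u0 u1 v0 v1, x0 ≤ u0 → u1 ≤ x1 → y0 ≤ v0 → v1 ≤ y1 →
      (u1 ≤ pl.re ∨ pr.re ≤ u0 ∨ v1 ≤ pb.im ∨ pt.im ≤ v0) →
      Disjoint (Ioo u0 u1 ×ℂ Ioo v0 v1) A := by
    intro u0 u1 v0 v1 h1 h2 h3 h4 h
    rw [Set.disjoint_left]
    rintro z ⟨⟨z1, z2⟩, ⟨z3, z4⟩⟩ hz
    have hzz : z ∈ A ∩ (Icc x0 x1 ×ℂ Icc y0 y1) :=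
      ⟨hz, ⟨by linarith, by linarith⟩, ⟨by linarith, by linarith⟩⟩
    have e1 := hl z hzz
    have e2 := hr z hzz
    have e3 := hb z hzz
    have e4 := ht z hzz
    rcases h with h | h | h | h <;> linarith
  have i1 := h0 x0 pl.re y0 y1 le_rfl l1 l2 le_rfl (by linarith) le_rfl
    (hdis _ _ _ _ le_rfl l2 le_rfl le_rfl (Or.inl le_rfl))
  have i2 := h0 pr.re x1 y0 y1 r1 r2 le_rfl le_rfl (by linarith) le_rfl
    (hdis _ _ _ _ r1 le_rfl le_rfl le_rfl (Or.inr (Or.inl le_rfl)))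
  have i3 := h0 pl.re pr.re y0 pb.im l1 hlr r2 le_rfl b3 b4
    (hdis _ _ _ _ l1 r2 le_rfl b4 (Or.inr (Or.inr (Or.inl le_rfl))))
  have i4 := h0 pl.re pr.re pt.im y1 l1 hlr r2 t3 t4 le_rfl
    (hdis _ _ _ _ l1 r2 t3 le_rfl (Or.inr (Or.inr (Or.inr le_rfl))))
  have hk := hκ.nonneg pl.re pr.re pb.im pt.im
  rw [rI_addx hF x0 pl.re x1, rI_addx hF pl.re pr.re x1, rI_addy hF pl.re pr.re y0 pb.im y1,
    rI_addy hF pl.re pr.re pb.im pt.im y1,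
    hκ.addx x0 pl.re x1 _ _ l1 l2, hκ.addx pl.re pr.re x1 _ _ hlr r2,
    hκ.addy pl.re pr.re y0 pb.im y1 b3 b4, hκ.addy pl.re pr.re pb.im pt.im y1 hbt t4]
  generalize rI F x0 pl.re y0 y1 = w1 at *
  generalize rI F pl.re pr.re y0 pb.im = w2 at *
  generalize rI F pl.re pr.re pb.im pt.im = w3 at *
  generalize rI F pl.re pr.re pt.im y1 = w4 at *
  generalize rI F pr.re x1 y0 y1 = w5 at *
  have n1 := norm_add_le w1 (w2 + (w3 + w4) + w5)
  have n2 := norm_add_le (w2 + (w3 + w4)) w5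
  have n3 := norm_add_le w2 (w3 + w4)
  have n4 := norm_add_le w3 w4
  linarith

/-- Horizontal subdivision. -/
lemma subx {F : ℂ → ℂ} (hF : Continuous F) {κ : ℝ → ℝ → ℝ → ℝ → ℝ} (hκ : AddRect κ)
    {x0 h y0 y1 : ℝ} (hh : 0 ≤ h) (m : ℕ)
    (H : ∀ k : ℕ, k < m →
      ‖rI F (x0 + k * h) (x0 + (k + 1) * h) y0 y1‖ ≤ κ (x0 + k * h) (x0 + (k + 1) * h) y0 y1) :
    ‖rI F x0 (x0 + m * h) y0 y1‖ ≤ κ x0 (x0 + m * h) y0 y1 := by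
  induction m with
  | zero =>
    have : rI F x0 (x0 + (0 : ℕ) * h) y0 y1 = 0 := by simp [rI]
    rw [this, norm_zero]; exact hκ.nonneg _ _ _ _
  | succ m ih =>
    have h1 := ih (fun k hk => H k (by omega))
    have h2 := H m (by omega)
    have hm : (0:ℝ) ≤ m * h := by positivity
    push_cast
    rw [rI_addx hF x0 (x0 + m * h), hκ.addx x0 (x0 + m * h) _ _ _ (by linarith) (by nlinarith)]
    exact (norm_add_le _ _).trans (add_le_add h1 h2)

/-- Vertical subdivision. -/
lemma suby {F : ℂ → ℂ} (hF : Continuous F) {κ : ℝ → ℝ → ℝ → ℝ → ℝ} (hκ : AddRect κ)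
    {x0 x1 h y0 : ℝ} (hh : 0 ≤ h) (m : ℕ)
    (H : ∀ k : ℕ, k < m →
      ‖rI F x0 x1 (y0 + k * h) (y0 + (k + 1) * h)‖ ≤ κ x0 x1 (y0 + k * h) (y0 + (k + 1) * h)) :
    ‖rI F x0 x1 y0 (y0 + m * h)‖ ≤ κ x0 x1 y0 (y0 + m * h) := by
  induction m with
  | zero =>
    have : rI F x0 x1 y0 (y0 + (0 : ℕ) * h) = 0 := by simp [rI]
    rw [this, norm_zero]; exact hκ.nonneg _ _ _ _
  | succ m ih =>
    have h1 := ih (fun k hk => H k (by omega))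
    have h2 := H m (by omega)
    have hm : (0:ℝ) ≤ m * h := by positivity
    push_cast
    rw [rI_addy hF _ _ y0 (y0 + m * h), hκ.addy _ _ y0 (y0 + m * h) _ (by linarith) (by nlinarith)]
    exact (norm_add_le _ _).trans (add_le_add h1 h2)

lemma sub_rect {F : ℂ → ℂ} (hF : Continuous F) {κ : ℝ → ℝ → ℝ → ℝ → ℝ} (hκ : AddRect κ)
    {x0 x1 y0 y1 δ : ℝ} (hx : x0 ≤ x1) (hy : y0 ≤ y1) (hδ : 0 < δ)
    (H : ∀ u0 u1 v0 v1, x0 ≤ u0 → u0 ≤ u1 → u1 ≤ x1 → y0 ≤ v0 → v0 ≤ v1 → v1 ≤ y1 →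
      v1 - v0 ≤ δ → u1 - u0 ≤ v1 - v0 → v1 - v0 ≤ 2 * (u1 - u0) →
      ‖rI F u0 u1 v0 v1‖ ≤ κ u0 u1 v0 v1) :
    ‖rI F x0 x1 y0 y1‖ ≤ κ x0 x1 y0 y1 := by
  rcases hx.eq_or_lt with rfl | hx
  · have : rI F x0 x0 y0 y1 = 0 := by simp [rI]
    rw [this, norm_zero]; exact hκ.nonneg _ _ _ _
  rcases hy.eq_or_lt with rfl | hy
  · have : rI F x0 x1 y0 y0 = 0 := by simp [rI]
    rw [this, norm_zero]; exact hκ.nonneg _ _ _ _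
  have ha : 0 < x1 - x0 := by linarith
  have hb : 0 < y1 - y0 := by linarith
  have hmin : 0 < min δ (x1 - x0) := lt_min hδ ha
  obtain ⟨n, hn⟩ := exists_nat_gt ((y1 - y0) / min δ (x1 - x0))
  have hn0 : (0:ℝ) < n := lt_of_le_of_lt (by positivity) hn
  set k := (y1 - y0) / n with hk
  have hk0 : 0 < k := by positivity
  have hkm : k ≤ min δ (x1 - x0) := by
    rw [hk, div_le_iff₀ hn0]
    rw [div_lt_iff₀ hmin] at hn
    linarith
  have hkδ := hkm.trans (min_le_left _ _)
  have hka := hkm.trans (min_le_right _ _)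
  obtain ⟨m, hm1, hm2⟩ : ∃ m : ℕ, (x1 - x0) / k ≤ m ∧ (m : ℝ) < (x1 - x0) / k + 1 :=
    ⟨_, Nat.le_ceil _, Nat.ceil_lt_add_one (by positivity)⟩
  have hm0 : (0:ℝ) < m := lt_of_lt_of_le (by positivity) hm1
  set h := (x1 - x0) / m with hh
  have hh0 : 0 < h := by positivity
  have hhk : h ≤ k := by
    rw [hh, div_le_iff₀ hm0]
    rw [div_le_iff₀ hk0] at hm1
    linarith
  have hkh : k ≤ 2 * h := by
    have e : (m:ℝ) * k < (x1 - x0) + k := by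
      have := mul_lt_mul_of_pos_right hm2 hk0
      rwa [add_mul, div_mul_cancel₀ _ hk0.ne', one_mul] at this
    rw [hh, ← mul_div_assoc, le_div_iff₀ hm0]
    linarith
  have ex : x1 = x0 + m * h := by rw [hh]; field_simp; ring
  have ey : y1 = y0 + n * k := by rw [hk]; field_simp; ring
  rw [ex, ey]
  refine subx hF hκ hh0.le m fun i hi => suby hF hκ hk0.le n fun j hj => ?_
  have hi' : ((i:ℝ) + 1) ≤ m := by exact_mod_cast hi
  have hj' : ((j:ℝ) + 1) ≤ n := by exact_mod_cast hj
  have hi0 : (0:ℝ) ≤ i * h := by positivity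
  have hj0 : (0:ℝ) ≤ j * k := by positivity
  have hi1 := mul_le_mul_of_nonneg_right hi' hh0.le
  have hj1 := mul_le_mul_of_nonneg_right hj' hk0.le
  apply H <;> linarith


lemma norm_sub_of_aligned {p q : ℂ} {L x0 x1 y0 y1 : ℝ} (hxL : x1 - x0 ≤ L) (hyL : y1 - y0 ≤ L)
    (hp : p ∈ Icc x0 x1 ×ℂ Icc y0 y1) (hq : q ∈ Icc x0 x1 ×ℂ Icc y0 y1)
    (h : q.re = p.re ∨ q.im = p.im) : ‖q - p‖ ≤ L := by
  obtain ⟨⟨p1, p2⟩, ⟨p3, p4⟩⟩ := hp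
  obtain ⟨⟨q1, q2⟩, ⟨q3, q4⟩⟩ := hq
  refine (Complex.norm_le_abs_re_add_abs_im _).trans ?_
  simp only [Complex.sub_re, Complex.sub_im]
  rcases h with h | h
  · rw [h, sub_self, abs_zero, zero_add, abs_le]; constructor <;> linarith
  · rw [h, sub_self, abs_zero, add_zero, abs_le]; constructor <;> linarith

lemma gen_bound {F : ℂ → ℂ} (hF : Continuous F) {A : Set ℂ} (hA : IsClosed A)
    {κ : ℝ → ℝ → ℝ → ℝ → ℝ} (hκ : AddRect κ) {x0 x1 y0 y1 : ℝ} (hx : x0 ≤ x1) (hy : y0 ≤ y1)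
    {M δ : ℝ} (hM0 : 0 ≤ M) (hδ : 0 < δ)
    (h0 : ∀ u0 u1 v0 v1, x0 ≤ u0 → u0 ≤ u1 → u1 ≤ x1 → y0 ≤ v0 → v0 ≤ v1 → v1 ≤ y1 →
      Disjoint (Ioo u0 u1 ×ℂ Ioo v0 v1) A → ‖rI F u0 u1 v0 v1‖ ≤ κ u0 u1 v0 v1)
    (hM : ∀ u0 u1 v0 v1, x0 ≤ u0 → u0 ≤ u1 → u1 ≤ x1 → y0 ≤ v0 → v0 ≤ v1 → v1 ≤ y1 →
      u1 - u0 ≤ δ → v1 - v0 ≤ δ → ∃ c : ℂ, ∀ p ∈ A, p ∈ Icc u0 u1 ×ℂ Icc v0 v1 →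
      ∀ q ∈ Icc u0 u1 ×ℂ Icc v0 v1,
      (q.re = p.re ∨ q.im = p.im) → ‖(F q - c * q) - (F p - c * p)‖ ≤ M * ‖q - p‖) :
    ‖rI F x0 x1 y0 y1‖ ≤ κ x0 x1 y0 y1 + kap (24 * M) A x0 x1 y0 y1 := by
  have main : ∀ r > 0, ‖rI F x0 x1 y0 y1‖ ≤
      κ x0 x1 y0 y1 + kap (24 * M) (Metric.cthickening r A) x0 x1 y0 y1 := by
    intro r hr
    have hk2 := addRect_kap (c := 24 * M) (by positivity) (Metric.cthickening r A)
    have hsum : AddRect (fun a b c d => κ a b c d + kap (24 * M) (Metric.cthickening r A) a b c d) :=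
      ⟨fun a b c d => add_nonneg (hκ.nonneg _ _ _ _) (hk2.nonneg _ _ _ _),
       fun a b c d e h1 h2 => by
        rw [hκ.addx a b c d e h1 h2, hk2.addx a b c d e h1 h2]; ring,
       fun a b c d e h1 h2 => by
        rw [hκ.addy a b c d e h1 h2, hk2.addy a b c d e h1 h2]; ring⟩
    refine sub_rect hF hsum hx hy (lt_min hδ (half_pos hr)) ?_
    intro u0 u1 v0 v1 a1 a2 a3 a4 a5 a6 hs hs1 hs2
    have hsδ := hs.trans (min_le_left _ _)
    have hsr := hs.trans (min_le_right _ _)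
    by_cases hne : (A ∩ (Icc u0 u1 ×ℂ Icc v0 v1)).Nonempty
    · obtain ⟨c, hc⟩ := hM u0 u1 v0 v1 a1 a2 a3 a4 a5 a6 (hs1.trans hsδ) hsδ
      rw [← rI_sub_affine hF c 0]
      have hb := bb (F := fun z => F z - (c * z + 0)) (by fun_prop) hA hκ
        (L := v1 - v0) (B := M * (v1 - v0)) hs1 le_rfl
        (mul_nonneg hM0 (by linarith))
        (fun w0 w1 t0 t1 b1 b2 b3 b4 b5 b6 hd => by
          rw [rI_sub_affine hF c 0]
          exact h0 w0 w1 t0 t1 (a1.trans b1) b2 (b3.trans a3) (a4.trans b4) b5 (b6.trans a6) hd)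
        (fun p hp hpR q hq hal => by
          simp only [add_zero]
          refine (hc p hp hpR q hq hal).trans ?_
          gcongr
          exact norm_sub_of_aligned hs1 le_rfl hpR hq hal) hne
      refine hb.trans (add_le_add le_rfl ?_)
      have hsub : Metric.cthickening r A ∩ (Ioc u0 u1 ×ℂ Ioc v0 v1) = Ioc u0 u1 ×ℂ Ioc v0 v1 := by
        refine inter_eq_right.2 ?_
        obtain ⟨p, hpA, ⟨p1, p2⟩, ⟨p3, p4⟩⟩ := hne
        rintro z ⟨⟨z1, z2⟩, ⟨z3, z4⟩⟩
        refine Metric.mem_cthickening_of_dist_le z p r A hpA ?_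
        rw [dist_eq_norm]
        refine (Complex.norm_le_abs_re_add_abs_im _).trans ?_
        simp only [Complex.sub_re, Complex.sub_im]
        have : |z.re - p.re| ≤ r / 2 := by rw [abs_le]; constructor <;> linarith
        have : |z.im - p.im| ≤ r / 2 := by rw [abs_le]; constructor <;> linarith
        linarith
      unfold kap
      rw [hsub, vol_rect a2 a5]
      have : (v1 - v0) * (v1 - v0) ≤ 2 * (u1 - u0) * (v1 - v0) :=
        mul_le_mul_of_nonneg_right hs2 (by linarith)
      nlinarith [mul_le_mul_of_nonneg_left this hM0]
    · have hd : Disjoint (Ioo u0 u1 ×ℂ Ioo v0 v1) A := by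
        rw [Set.disjoint_left]
        rintro z ⟨⟨z1, z2⟩, ⟨z3, z4⟩⟩ hz
        exact hne ⟨z, hz, ⟨z1.le, z2.le⟩, ⟨z3.le, z4.le⟩⟩
      refine (h0 u0 u1 v0 v1 a1 a2 a3 a4 a5 a6 hd).trans ?_
      have := hk2.nonneg u0 u1 v0 v1
      linarith
  have hlim : Tendsto (fun r => κ x0 x1 y0 y1 + kap (24 * M) (Metric.cthickening r A) x0 x1 y0 y1)
      (𝓝[>] 0) (𝓝 (κ x0 x1 y0 y1 + kap (24 * M) A x0 x1 y0 y1)) := by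
    refine tendsto_const_nhds.add ?_
    unfold kap
    refine Tendsto.const_mul _ ?_
    set μ := MeasureTheory.volume.restrict (Ioc x0 x1 ×ℂ Ioc y0 y1) with hμ
    have hfin : ∀ E : Set ℂ, MeasurableSet E →
        μ E = MeasureTheory.volume (E ∩ (Ioc x0 x1 ×ℂ Ioc y0 y1)) := fun E hE =>
      MeasureTheory.Measure.restrict_apply hE
    have ht := tendsto_measure_cthickening_of_isClosed (μ := μ) (s := A)
      ⟨1, one_pos, by
        rw [hfin _ Metric.isClosed_cthickening.measurableSet]; exact vol_rect_ne_top _ _ _ _ _⟩ hA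
    have ht2 := (ENNReal.tendsto_toReal (by
        rw [hfin _ hA.measurableSet]; exact vol_rect_ne_top _ _ _ _ _)).comp ht
    refine Tendsto.congr' ?_ ((by
      simpa only [hfin _ hA.measurableSet] using ht2 :
      Tendsto _ _ (𝓝 (MeasureTheory.volume (A ∩ (Ioc x0 x1 ×ℂ Ioc y0 y1))).toReal)).mono_left
        nhdsWithin_le_nhds)
    refine Eventually.of_forall fun r => ?_
    simp only [Function.comp, hfin _ Metric.isClosed_cthickening.measurableSet]
    rfl
  exact ge_of_tendsto hlim (eventually_mem_nhdsWithin.mono fun r hr => main r hr)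

lemma vol_re_eq (a : ℝ) : MeasureTheory.volume {z : ℂ | z.re = a} = 0 := by
  have h : {z : ℂ | z.re = a} = Complex.measurableEquivRealProd ⁻¹' ({a} ×ˢ univ) := by
    ext z; simp
  rw [h, Complex.volume_preserving_equiv_real_prod.measure_preimage_equiv,
    MeasureTheory.Measure.volume_eq_prod, MeasureTheory.Measure.prod_prod]
  simp

lemma vol_im_eq (a : ℝ) : MeasureTheory.volume {z : ℂ | z.im = a} = 0 := by
  have h : {z : ℂ | z.im = a} = Complex.measurableEquivRealProd ⁻¹' (univ ×ˢ {a}) := by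
    ext z; simp
  rw [h, Complex.volume_preserving_equiv_real_prod.measure_preimage_equiv,
    MeasureTheory.Measure.volume_eq_prod, MeasureTheory.Measure.prod_prod]
  simp

lemma kap_le_of_disjoint {c : ℝ} (hc : 0 ≤ c) {P A S : Set ℂ} {u0 u1 v0 v1 : ℝ}
    (hd : Disjoint (Ioo u0 u1 ×ℂ Ioo v0 v1) A)
    (hS : ∀ z ∈ P, z ∈ Icc u0 u1 ×ℂ Icc v0 v1 → z ∉ A → z ∈ S) :
    kap c P u0 u1 v0 v1 ≤ kap c S u0 u1 v0 v1 := by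
  unfold kap
  refine mul_le_mul_of_nonneg_left ?_ hc
  refine ENNReal.toReal_mono (vol_rect_ne_top _ _ _ _ _) ?_
  calc MeasureTheory.volume (P ∩ (Ioc u0 u1 ×ℂ Ioc v0 v1))
      ≤ MeasureTheory.volume ((S ∩ (Ioc u0 u1 ×ℂ Ioc v0 v1)) ∪
          ({z : ℂ | z.re = u1} ∪ {z : ℂ | z.im = v1})) := by
        apply MeasureTheory.measure_mono
        rintro z ⟨hz, ⟨z1, z2⟩, ⟨z3, z4⟩⟩
        by_cases h1 : z.re = u1
        · exact Or.inr (Or.inl h1)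
        by_cases h2 : z.im = v1
        · exact Or.inr (Or.inr h2)
        refine Or.inl ⟨hS z hz ⟨⟨z1.le, z2⟩, ⟨z3.le, z4⟩⟩ ?_, ⟨z1, z2⟩, ⟨z3, z4⟩⟩
        exact Set.disjoint_left.1 hd ⟨⟨z1, lt_of_le_of_ne z2 h1⟩, ⟨z3, lt_of_le_of_ne z4 h2⟩⟩
    _ ≤ _ := MeasureTheory.measure_union_le _ _
    _ ≤ MeasureTheory.volume (S ∩ (Ioc u0 u1 ×ℂ Ioc v0 v1)) + 0 := by
        gcongr
        refine (MeasureTheory.measure_union_le _ _).trans ?_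
        rw [vol_re_eq, vol_im_eq, add_zero]
    _ = _ := add_zero _

lemma aligned_eq {p q : ℂ} (h : q.re = p.re ∨ q.im = p.im) :
    ∃ t : ℝ, |t| = ‖q - p‖ ∧ (q = p + t ∨ q = p + t * Complex.I) := by
  rcases h with h | h
  · have e : q = p + ((q.im - p.im : ℝ) : ℂ) * Complex.I := by
      apply Complex.ext <;> simp [h]
    refine ⟨q.im - p.im, ?_, Or.inr e⟩
    conv_rhs => rw [e]
    rw [add_sub_cancel_left, norm_mul, Complex.norm_I, mul_one, Complex.norm_real,
      Real.norm_eq_abs]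
  · have e : q = p + ((q.re - p.re : ℝ) : ℂ) := by
      apply Complex.ext <;> simp [h]
    refine ⟨q.re - p.re, ?_, Or.inl e⟩
    conv_rhs => rw [e]
    rw [add_sub_cancel_left, Complex.norm_real, Real.norm_eq_abs]

/-- First step: the boundary integral is controlled by the area of the bad set. -/
lemma step_one {F : ℂ → ℂ} (hF : Continuous F) {P : Set ℂ} (hP : IsClosed P)
    (hPa : ∀ z, z ∉ P → AnalyticAt ℂ F z) {x0 x1 y0 y1 N : ℝ} (hx : x0 ≤ x1) (hy : y0 ≤ y1)
    (hx1 : x1 - x0 ≤ 1) (hy1 : y1 - y0 ≤ 1) (hN0 : 0 ≤ N)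
    (hN : ∀ p ∈ P, p ∈ Icc x0 x1 ×ℂ Icc y0 y1 → ∀ t : ℝ, |t| ≤ 1 →
      ‖F (p + t) - F p‖ ≤ N * |t| ∧ ‖F (p + t * Complex.I) - F p‖ ≤ N * |t|) :
    ‖rI F x0 x1 y0 y1‖ ≤ kap (24 * N) P x0 x1 y0 y1 := by
  have hκ : AddRect (fun _ _ _ _ => (0 : ℝ)) := ⟨by simp, by simp, by simp⟩
  have := gen_bound hF hP hκ hx hy hN0 one_pos ?_ ?_
  · simpa using this
  · intro u0 u1 v0 v1 a1 a2 a3 a4 a5 a6 hd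
    have := Complex.integral_boundary_rect_eq_zero_of_continuousOn_of_differentiableOn F
      (⟨u0, v0⟩ : ℂ) (⟨u1, v1⟩ : ℂ) hF.continuousOn (by
        simp only [min_eq_left a2, max_eq_right a2, min_eq_left a5, max_eq_right a5]
        intro z hz
        exact (hPa z (Set.disjoint_left.1 hd hz)).differentiableAt.differentiableWithinAt)
    have h2 : rI F u0 u1 v0 v1 = 0 := this
    rw [h2, norm_zero]
  · intro u0 u1 v0 v1 a1 a2 a3 a4 a5 a6 _ _
    refine ⟨0, fun p hp hpR q hq hal => ?_⟩
    have hpR' : p ∈ Icc x0 x1 ×ℂ Icc y0 y1 :=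
      ⟨⟨a1.trans hpR.1.1, hpR.1.2.trans a3⟩, ⟨a4.trans hpR.2.1, hpR.2.2.trans a6⟩⟩
    have hle : ‖q - p‖ ≤ 1 :=
      norm_sub_of_aligned (L := 1) (by linarith) (by linarith) hpR hq hal
    obtain ⟨t, ht, hq'⟩ := aligned_eq hal
    rw [← ht] at hle ⊢
    have := hN p hp hpR' t hle
    simp only [zero_mul, sub_zero]
    rcases hq' with h | h <;> rw [h]
    exacts [this.1, this.2]

/-- Second step: the boundary integral vanishes. -/
lemma step_two {F : ℂ → ℂ} (hF : Continuous F) {P : Set ℂ} (hP : IsClosed P)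
    (hPa : ∀ z, z ∉ P → AnalyticAt ℂ F z) {x0 x1 y0 y1 N : ℝ} (hx : x0 ≤ x1) (hy : y0 ≤ y1)
    (hx1 : x1 - x0 ≤ 1) (hy1 : y1 - y0 ≤ 1) (hN0 : 0 ≤ N)
    (hN : ∀ p ∈ P, p ∈ Icc x0 x1 ×ℂ Icc y0 y1 → ∀ t : ℝ, |t| ≤ 1 →
      ‖F (p + t) - F p‖ ≤ N * |t| ∧ ‖F (p + t * Complex.I) - F p‖ ≤ N * |t|)
    (hd : ∀ p ∈ P, p ∈ Icc x0 x1 ×ℂ Icc y0 y1 → ∃ d : ℂ, ∀ ε > 0, ∃ δ > 0, ∀ t : ℝ, |t| ≤ δ →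
      ‖F (p + t) - F p - t * d‖ ≤ ε * |t| ∧
      ‖F (p + t * Complex.I) - F p - t * Complex.I * d‖ ≤ ε * |t|) :
    rI F x0 x1 y0 y1 = 0 := by
  set Q : Set ℂ := Icc x0 x1 ×ℂ Icc y0 y1 with hQ
  have hQc : IsCompact Q := isCompact_Icc.reProdIm isCompact_Icc
  have main : ∀ ε > 0, ‖rI F x0 x1 y0 y1‖ ≤
      ε * (24 * N + 48 * ((x1 - x0) * (y1 - y0))) := by
    intro ε hε
    let s : ℕ → ℝ := fun n => 1 / ((n : ℝ) + 1)
    have hs0 : ∀ n, 0 < s n := fun n => by positivity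
    have hs1 : ∀ n, s n ≤ 1 := fun n => by
      simp only [s]; rw [div_le_one (by positivity)]; linarith [n.cast_nonneg (α := ℝ)]
    let D : ℕ → ℂ → ℂ := fun n w => (F (w + s n) - F w) / (s n : ℂ)
    have hD : ∀ n, Continuous (D n) := fun n => by
      simp only [D]; fun_prop
    let A : ℕ → Set ℂ := fun n => (P ∩ Q) ∩ ⋂ (t : ℝ) (_ : |t| ≤ s n),
      ({w : ℂ | ‖F (w + t) - F w - t * D n w‖ ≤ ε * |t|} ∩
       {w : ℂ | ‖F (w + t * Complex.I) - F w - t * Complex.I * D n w‖ ≤ ε * |t|})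
    have hAc : ∀ n, IsClosed (A n) := fun n => by
      refine (hP.inter hQc.isClosed).inter (isClosed_biInter fun t _ => IsClosed.inter ?_ ?_)
      · exact isClosed_le (by have := hD n; fun_prop) continuous_const
      · exact isClosed_le (by have := hD n; fun_prop) continuous_const
    have hAmem : ∀ n w, w ∈ A n → ∀ t : ℝ, |t| ≤ s n →
        ‖F (w + t) - F w - t * D n w‖ ≤ ε * |t| ∧
        ‖F (w + t * Complex.I) - F w - t * Complex.I * D n w‖ ≤ ε * |t| := by
      intro n w hw t ht
      have := mem_iInter₂.1 hw.2 t ht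
      exact this
    have hAev : ∀ w ∈ P ∩ Q, ∃ n0, ∀ n ≥ n0, w ∈ A n := by
      rintro w ⟨hwP, hwQ⟩
      obtain ⟨d, hd⟩ := hd w hwP hwQ
      obtain ⟨δ, hδ, hd⟩ := hd (ε / 2) (half_pos hε)
      obtain ⟨n0, hn0⟩ := exists_nat_one_div_lt hδ
      refine ⟨n0, fun n hn => ⟨⟨hwP, hwQ⟩, mem_iInter₂.2 fun t ht => ?_⟩⟩
      have hsn : s n ≤ δ := by
        refine le_trans ?_ hn0.le
        exact one_div_le_one_div_of_le (by positivity) (by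
          have : (n0:ℝ) ≤ n := by exact_mod_cast hn
          linarith)
      have hsd := (hd (s n) (by rwa [abs_of_pos (hs0 n)])).1
      have hsne : (s n : ℂ) ≠ 0 := by exact_mod_cast (hs0 n).ne'
      have hDd : ‖D n w - d‖ ≤ ε / 2 := by
        have e : D n w - d = (F (w + s n) - F w - s n * d) / (s n : ℂ) := by
          simp only [D]; field_simp
        rw [e, norm_div, Complex.norm_real, Real.norm_eq_abs, div_le_iff₀ (abs_pos.2 (hs0 n).ne')]
        exact hsd
      have htd := hd t (ht.trans hsn)
      constructor
      · change ‖F (w + t) - F w - t * D n w‖ ≤ ε * |t|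
        calc ‖F (w + t) - F w - t * D n w‖
            = ‖(F (w + t) - F w - t * d) - t * (D n w - d)‖ := by congr 1; ring
          _ ≤ ‖F (w + t) - F w - t * d‖ + ‖(t:ℂ) * (D n w - d)‖ := norm_sub_le _ _
          _ ≤ ε / 2 * |t| + |t| * (ε / 2) := by
              rw [norm_mul, Complex.norm_real, Real.norm_eq_abs]
              gcongr
              exact htd.1
          _ = ε * |t| := by ring
      · change ‖F (w + t * Complex.I) - F w - t * Complex.I * D n w‖ ≤ ε * |t|
        calc ‖F (w + t * Complex.I) - F w - t * Complex.I * D n w‖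
            = ‖(F (w + t * Complex.I) - F w - t * Complex.I * d)
                - t * Complex.I * (D n w - d)‖ := by congr 1; ring
          _ ≤ ‖F (w + t * Complex.I) - F w - t * Complex.I * d‖
                + ‖(t:ℂ) * Complex.I * (D n w - d)‖ := norm_sub_le _ _
          _ ≤ ε / 2 * |t| + |t| * (ε / 2) := by
              rw [norm_mul, norm_mul, Complex.norm_I, mul_one, Complex.norm_real,
                Real.norm_eq_abs]
              gcongr
              exact htd.2
          _ = ε * |t| := by ring
    let B : ℕ → Set ℂ := fun n => ⋂ (m : ℕ) (_ : n ≤ m), A m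
    have hBc : ∀ n, IsClosed (B n) := fun n => isClosed_biInter fun m _ => hAc m
    have hBA : ∀ n, B n ⊆ A n := fun n => biInter_subset_of_mem (le_refl n)
    let S : ℕ → Set ℂ := fun n => (P ∩ Q) \ B n
    have hSanti : Antitone S := by
      intro n m hnm z hz
      refine ⟨hz.1, fun h => hz.2 ?_⟩
      exact mem_iInter₂.2 fun k hk => mem_iInter₂.1 h k (hnm.trans hk)
    have hPQ : MeasurableSet (P ∩ Q) := (hP.inter hQc.isClosed).measurableSet
    have hSm : ∀ n, MeasurableSet (S n) := fun n => hPQ.diff (hBc n).measurableSet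
    have hSfin : ∀ n, MeasureTheory.volume (S n) ≠ ⊤ := fun n =>
      ((hQc.isBounded.subset (fun z hz => hz.1.2)).measure_lt_top).ne
    have hSempty : (⋂ n, S n) = ∅ := by
      rw [Set.eq_empty_iff_forall_notMem]
      intro z hz
      have hz' := mem_iInter.1 hz
      obtain ⟨n0, hn0⟩ := hAev z (hz' 0).1
      exact (hz' n0).2 (mem_iInter₂.2 fun k hk => hn0 k hk)
    have hSt : Tendsto (fun n => MeasureTheory.volume (S n)) atTop (𝓝 0) := by
      have := MeasureTheory.tendsto_measure_iInter_atTop (μ := MeasureTheory.volume)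
        (fun n => (hSm n).nullMeasurableSet) hSanti ⟨0, hSfin 0⟩
      rwa [hSempty, MeasureTheory.measure_empty] at this
    obtain ⟨n, hn⟩ : ∃ n, MeasureTheory.volume (S n) < ENNReal.ofReal ε :=
      (hSt.eventually (gt_mem_nhds (by simpa using hε))).exists
    have hn' : MeasureTheory.volume.real (S n) ≤ ε :=
      ENNReal.toReal_le_of_le_ofReal hε.le hn.le
    -- uniform continuity
    obtain ⟨δ, hδ, hu⟩ := Metric.uniformContinuousOn_iff.1
      (hQc.uniformContinuousOn_of_continuous (hD n).continuousOn) ε hε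
    have hκ := addRect_kap (c := 24 * N) (by positivity) (S n)
    have hfin := gen_bound hF (hBc n) hκ hx hy (M := 2 * ε) (δ := min (s n) (δ / 3)) (by positivity)
      (lt_min (hs0 n) (by positivity)) ?_ ?_
    · refine hfin.trans ?_
      have e1 : kap (24 * N) (S n) x0 x1 y0 y1 ≤ 24 * N * ε := by
        unfold kap
        refine mul_le_mul_of_nonneg_left (le_trans ?_ hn') (by positivity)
        exact ENNReal.toReal_mono (hSfin n) (MeasureTheory.measure_mono inter_subset_left)
      have e2 : kap (24 * (2 * ε)) (B n) x0 x1 y0 y1 ≤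
          24 * (2 * ε) * ((x1 - x0) * (y1 - y0)) := by
        unfold kap
        refine mul_le_mul_of_nonneg_left ?_ (by positivity)
        rw [← vol_rect hx hy]
        refine ENNReal.toReal_mono ?_ (MeasureTheory.measure_mono inter_subset_right)
        have := vol_rect_ne_top univ x0 x1 y0 y1
        rwa [univ_inter] at this
      linarith
    · intro u0 u1 v0 v1 a1 a2 a3 a4 a5 a6 hdis
      have hsub : ∀ z ∈ Icc u0 u1 ×ℂ Icc v0 v1, z ∈ Q := fun z hz =>
        ⟨⟨a1.trans hz.1.1, hz.1.2.trans a3⟩, ⟨a4.trans hz.2.1, hz.2.2.trans a6⟩⟩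
      refine (step_one hF hP hPa a2 a5 (by linarith) (by linarith) hN0
        (fun p hp hpR => hN p hp (hsub p hpR))).trans ?_
      exact kap_le_of_disjoint (by positivity) hdis fun z hz hzR hzA => ⟨⟨hz, hsub z hzR⟩, hzA⟩
    · intro u0 u1 v0 v1 a1 a2 a3 a4 a5 a6 hu1 hv1
      have hsub : ∀ z ∈ Icc u0 u1 ×ℂ Icc v0 v1, z ∈ Q := fun z hz =>
        ⟨⟨a1.trans hz.1.1, hz.1.2.trans a3⟩, ⟨a4.trans hz.2.1, hz.2.2.trans a6⟩⟩
      set c0 : ℂ := ⟨u0, v0⟩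
      have hc0 : c0 ∈ Icc u0 u1 ×ℂ Icc v0 v1 := ⟨⟨le_rfl, a2⟩, ⟨le_rfl, a5⟩⟩
      refine ⟨D n c0, fun p hp hpR q hq hal => ?_⟩
      have hDp : ‖D n p - D n c0‖ ≤ ε := by
        have := hu p (hsub p hpR) c0 (hsub c0 hc0) ?_
        · rw [dist_eq_norm] at this; exact this.le
        · rw [dist_eq_norm]
          refine (Complex.norm_le_abs_re_add_abs_im _).trans_lt ?_
          obtain ⟨⟨p1, p2⟩, ⟨p3, p4⟩⟩ := hpR
          have hu2 := hu1.trans (min_le_right _ _)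
          have hv2 := hv1.trans (min_le_right _ _)
          have : |(p - c0).re| ≤ δ / 3 := by
            rw [abs_le]; simp only [c0, Complex.sub_re]; constructor <;> linarith
          have : |(p - c0).im| ≤ δ / 3 := by
            rw [abs_le]; simp only [c0, Complex.sub_im]; constructor <;> linarith
          linarith
      have hle : ‖q - p‖ ≤ s n :=
        norm_sub_of_aligned (hu1.trans (min_le_left _ _)) (hv1.trans (min_le_left _ _)) hpR hq hal
      have key : ‖F q - F p - (q - p) * D n p‖ ≤ ε * ‖q - p‖ := by
        obtain ⟨t, ht, hq'⟩ := aligned_eq hal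
        rw [← ht] at hle ⊢
        have := hAmem n p (hBA n hp) t hle
        rcases hq' with h | h <;> rw [h, add_sub_cancel_left]
        exacts [this.1, this.2]
      calc ‖F q - D n c0 * q - (F p - D n c0 * p)‖
          = ‖(F q - F p - (q - p) * D n p) + (q - p) * (D n p - D n c0)‖ := by congr 1; ring
        _ ≤ _ := norm_add_le _ _
        _ ≤ ε * ‖q - p‖ + ‖q - p‖ * ε := by
            rw [norm_mul]; gcongr
        _ = 2 * ε * ‖q - p‖ := by ring
  have hC : 0 ≤ 24 * N + 48 * ((x1 - x0) * (y1 - y0)) := by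
    have := mul_nonneg (sub_nonneg.2 hx) (sub_nonneg.2 hy)
    positivity
  have hlim : Tendsto (fun ε : ℝ => ε * (24 * N + 48 * ((x1 - x0) * (y1 - y0)))) (𝓝[>] 0) (𝓝 0) := by
    have : Tendsto (fun ε : ℝ => ε * (24 * N + 48 * ((x1 - x0) * (y1 - y0)))) (𝓝 0)
        (𝓝 (0 * (24 * N + 48 * ((x1 - x0) * (y1 - y0))))) := tendsto_id.mul_const _
    rw [zero_mul] at this
    exact this.mono_left nhdsWithin_le_nhds
  exact norm_le_zero_iff.1 (ge_of_tendsto hlim (eventually_mem_nhdsWithin.mono fun r hr => main r hr))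

lemma eps_of_hasDerivAt {F : ℂ → ℂ} {w v d : ℂ}
    (h : HasDerivAt (fun t : ℝ => F (w + t * v)) (v * d) 0) {ε : ℝ} (hε : 0 < ε) :
    ∃ δ > 0, ∀ t : ℝ, |t| ≤ δ → ‖F (w + t * v) - F w - t * v * d‖ ≤ ε * |t| := by
  rw [hasDerivAt_iff_isLittleO] at h
  have h1 := h.def hε
  rw [Metric.eventually_nhds_iff_ball] at h1
  obtain ⟨δ, hδ, h1⟩ := h1
  refine ⟨δ / 2, half_pos hδ, fun t ht => ?_⟩
  have := h1 t (by rw [Metric.mem_ball, dist_zero_right, Real.norm_eq_abs]; linarith)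
  simpa [mul_assoc] using this

/-- A Looman-Menchoff type theorem for globally continuous functions. -/
lemma looman_cont {F : ℂ → ℂ} (hF : Continuous F) {U : Set ℂ} (hU : IsOpen U)
    (hd : ∀ w ∈ U, ∃ d, HasDerivAt (fun t : ℝ => F (w + t * 1)) (1 * d) 0 ∧
      HasDerivAt (fun t : ℝ => F (w + t * Complex.I)) (Complex.I * d) 0) :
    ∀ w ∈ U, AnalyticAt ℂ F w := by
  have hd' : ∀ p ∈ U, ∃ d : ℂ, ∀ ε > 0, ∃ δ > 0, ∀ t : ℝ, |t| ≤ δ →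
      ‖F (p + t) - F p - t * d‖ ≤ ε * |t| ∧
      ‖F (p + t * Complex.I) - F p - t * Complex.I * d‖ ≤ ε * |t| := by
    intro p hp
    obtain ⟨d, h1, h2⟩ := hd p hp
    refine ⟨d, fun ε hε => ?_⟩
    obtain ⟨δ1, hδ1, g1⟩ := eps_of_hasDerivAt h1 hε
    obtain ⟨δ2, hδ2, g2⟩ := eps_of_hasDerivAt h2 hε
    refine ⟨min δ1 δ2, lt_min hδ1 hδ2, fun t ht => ⟨?_, g2 t (ht.trans (min_le_right _ _))⟩⟩
    simpa using g1 t (ht.trans (min_le_left _ _))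
  by_contra! hcon
  obtain ⟨w, hwU, hw⟩ := hcon
  set P : Set ℂ := {z | AnalyticAt ℂ F z}ᶜ with hPdef
  have hP : IsClosed P := (isOpen_analyticAt ℂ F).isClosed_compl
  have hPa : ∀ z, z ∉ P → AnalyticAt ℂ F z := fun z hz => not_not.1 hz
  have hwP : w ∈ P := hw
  obtain ⟨ρ, hρ, hball⟩ := Metric.isOpen_iff.1 hU w hwU
  set X : Set ℂ := closure (P ∩ Metric.ball w (ρ / 2)) with hX
  have hXP : X ⊆ P := closure_minimal inter_subset_left hP
  have hXU : X ⊆ U := by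
    refine subset_trans ?_ hball
    refine (closure_mono inter_subset_right).trans (Metric.closure_ball_subset_closedBall.trans ?_)
    exact Metric.closedBall_subset_ball (by linarith)
  have hXc : IsClosed X := isClosed_closure
  have hwX : w ∈ X := subset_closure ⟨hwP, Metric.mem_ball_self (by linarith)⟩
  haveI : CompleteSpace X := hXc.completeSpace_coe
  haveI : Nonempty X := ⟨⟨w, hwX⟩⟩
  let C : ℕ → Set ℂ := fun N => ⋂ (t : ℝ) (_ : |t| ≤ 1),
      ({p : ℂ | ‖F (p + t) - F p‖ ≤ N * |t|} ∩ {p : ℂ | ‖F (p + t * Complex.I) - F p‖ ≤ N * |t|})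
  have hCc : ∀ N, IsClosed (C N) := fun N => by
    refine isClosed_biInter fun t _ => IsClosed.inter ?_ ?_
    · exact isClosed_le (by fun_prop) continuous_const
    · exact isClosed_le (by fun_prop) continuous_const
  have hcov : ∀ p ∈ U, ∃ N, p ∈ C N := by
    intro p hp
    obtain ⟨d, hdp⟩ := hd' p hp
    obtain ⟨δ, hδ, hdp⟩ := hdp 1 one_pos
    obtain ⟨K, hK⟩ := (isCompact_closedBall p 1).exists_bound_of_continuousOn hF.continuousOn
    have hK0 : 0 ≤ K := (norm_nonneg _).trans (hK p (Metric.mem_closedBall_self zero_le_one))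
    obtain ⟨N, hN⟩ := exists_nat_ge (max (1 + ‖d‖) (2 * K / δ))
    have hN1 := (le_max_left _ _).trans hN
    have hN2 := (le_max_right _ _).trans hN
    have gen : ∀ v : ℂ, ‖v‖ = 1 → ∀ t : ℝ, |t| ≤ 1 →
        (|t| ≤ δ → ‖F (p + t * v) - F p - t * v * d‖ ≤ 1 * |t|) →
        ‖F (p + t * v) - F p‖ ≤ N * |t| := by
      intro v hv t ht h
      by_cases htδ : |t| ≤ δ
      · calc ‖F (p + t * v) - F p‖ = ‖(F (p + t * v) - F p - t * v * d) + t * v * d‖ := by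
              congr 1; ring
          _ ≤ _ := norm_add_le _ _
          _ ≤ 1 * |t| + |t| * ‖d‖ := by
              refine add_le_add (h htδ) ?_
              rw [norm_mul, norm_mul, hv, Complex.norm_real, Real.norm_eq_abs, mul_one]
          _ = (1 + ‖d‖) * |t| := by ring
          _ ≤ N * |t| := by gcongr
      · push Not at htδ
        have m1 := hK (p + t * v) (by
          rw [Metric.mem_closedBall, dist_eq_norm, add_sub_cancel_left, norm_mul, hv,
            Complex.norm_real, Real.norm_eq_abs, mul_one]; exact ht)
        have m2 := hK p (Metric.mem_closedBall_self zero_le_one)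
        have m3 : 2 * K ≤ N * |t| := by
          calc 2 * K = 2 * K / δ * δ := by field_simp
            _ ≤ N * |t| := by gcongr
        have := norm_sub_le (F (p + t * v)) (F p)
        linarith
    refine ⟨N, mem_iInter₂.2 fun t ht => ⟨?_, ?_⟩⟩
    · change ‖F (p + t) - F p‖ ≤ N * |t|
      have := gen 1 norm_one t ht (fun h => by simpa using (hdp t h).1)
      simpa using this
    · exact gen Complex.I Complex.norm_I t ht (fun h => (hdp t h).2)
  obtain ⟨N, x, hx⟩ := nonempty_interior_of_iUnion_of_closed
    (f := fun N => ((↑) : X → ℂ) ⁻¹' C N)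
    (fun N => (hCc N).preimage continuous_subtype_val) (by
      rw [eq_univ_iff_forall]
      intro x
      obtain ⟨N, hN⟩ := hcov x (hXU x.2)
      exact mem_iUnion.2 ⟨N, hN⟩)
  obtain ⟨V', hV'sub, hV'o, hxV'⟩ := mem_interior.1 hx
  obtain ⟨V, hV, rfl⟩ := isOpen_induced_iff.1 hV'o
  obtain ⟨v, hvV, hvP, hvb⟩ := mem_closure_iff.1 x.2 V hV hxV'
  obtain ⟨r, hr, hrsub⟩ := Metric.isOpen_iff.1 (hV.inter Metric.isOpen_ball) v ⟨hvV, hvb⟩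
  have hPN : ∀ p ∈ P, p ∈ Metric.ball v r → p ∈ C N ∧ p ∈ U := by
    intro p hp hpr
    have h := hrsub hpr
    have hpX : p ∈ X := subset_closure ⟨hp, h.2⟩
    exact ⟨hV'sub (a := ⟨p, hpX⟩) h.1, hXU hpX⟩
  have hr' : 0 < min r (1 / 2) := lt_min hr (by norm_num)
  -- integrals over rectangles vanish
  have key : ∀ x0 x1 y0 y1 : ℝ, x0 ≤ x1 → y0 ≤ y1 →
      Icc x0 x1 ×ℂ Icc y0 y1 ⊆ Metric.ball v (min r (1 / 2)) → rI F x0 x1 y0 y1 = 0 := by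
    intro x0 x1 y0 y1 hx hy hsub
    have hsz : ∀ p ∈ Icc x0 x1 ×ℂ Icc y0 y1, ∀ q ∈ Icc x0 x1 ×ℂ Icc y0 y1, ‖p - q‖ ≤ 1 := by
      intro p hp q hq
      have h1 := Metric.mem_ball.1 (hsub hp)
      have h2 := Metric.mem_ball.1 (hsub hq)
      have h3 := min_le_right r (1 / 2)
      rw [← dist_eq_norm]
      have := dist_triangle_right p q v
      linarith
    have hsub' : ∀ p ∈ Icc x0 x1 ×ℂ Icc y0 y1, p ∈ Metric.ball v r := fun p hp =>
      Metric.ball_subset_ball (min_le_left _ _) (hsub hp)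
    have c1 : (⟨x0, y0⟩ : ℂ) ∈ Icc x0 x1 ×ℂ Icc y0 y1 := ⟨⟨le_rfl, hx⟩, ⟨le_rfl, hy⟩⟩
    have c2 : (⟨x1, y1⟩ : ℂ) ∈ Icc x0 x1 ×ℂ Icc y0 y1 := ⟨⟨hx, le_rfl⟩, ⟨hy, le_rfl⟩⟩
    have h12 := hsz _ c2 _ c1
    have hre := (Complex.abs_re_le_norm _).trans h12
    have him := (Complex.abs_im_le_norm _).trans h12
    simp only [Complex.sub_re, Complex.sub_im] at hre him
    refine step_two hF hP hPa hx hy ((le_abs_self _).trans hre) ((le_abs_self _).trans him)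
      (N := N) (Nat.cast_nonneg N) ?_ ?_
    · intro p hp hpR t ht
      have := mem_iInter₂.1 (hPN p hp (hsub' p hpR)).1 t ht
      exact this
    · intro p hp hpR
      exact hd' p (hPN p hp (hsub' p hpR)).2
  have hcons : Complex.IsConservativeOn F (Metric.ball v (min r (1 / 2))) := by
    intro z z' hzz
    rw [← add_eq_zero_iff_eq_neg, Complex.wedgeIntegral_add_wedgeIntegral_eq]
    change rI F z.re z'.re z.im z'.im = 0
    have hsx : ∀ a b c d, rI F a b c d = - rI F b a c d := by
      intro a b c d
      simp only [rI, intervalIntegral.integral_symm b a]; ring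
    have hsy : ∀ a b c d, rI F a b c d = - rI F a b d c := by
      intro a b c d
      simp only [rI, intervalIntegral.integral_symm d c, smul_neg]; ring
    have hk := key (min z.re z'.re) (max z.re z'.re) (min z.im z'.im) (max z.im z'.im)
      min_le_max min_le_max hzz
    rcases le_total z.re z'.re with h1 | h1 <;> rcases le_total z.im z'.im with h2 | h2 <;>
      simp only [h1, h2, min_eq_left, min_eq_right, max_eq_left, max_eq_right] at hk
    · exact hk
    · rw [hsy, hk, neg_zero]
    · rw [hsx, hk, neg_zero]
    · rw [hsx, hsy, hk, neg_zero, neg_zero]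
  have hdiff : DifferentiableOn ℂ F (Metric.ball v (min r (1 / 2))) :=
    (Complex.isConservativeOn_and_continuousOn_iff_isDifferentiableOn Metric.isOpen_ball).1
      ⟨hcons, hF.continuousOn⟩
  exact hvP (hdiff.analyticAt (Metric.ball_mem_nhds v hr'))

lemma looman {F : ℂ → ℂ} {U : Set ℂ} (hU : IsOpen U) (hF : ContinuousOn F U)
    (hd : ∀ w ∈ U, ∃ d, HasDerivAt (fun t : ℝ => F (w + t * 1)) (1 * d) 0 ∧
      HasDerivAt (fun t : ℝ => F (w + t * Complex.I)) (Complex.I * d) 0) :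
    AnalyticOnNhd ℂ F U := by
  intro w hw
  obtain ⟨ρ, hρ, hball⟩ := Metric.isOpen_iff.1 hU w hw
  have hsub : Metric.closedBall w (ρ / 2) ⊆ U :=
    (Metric.closedBall_subset_ball (by linarith)).trans hball
  obtain ⟨G, hG⟩ := ContinuousMap.exists_restrict_eq (Metric.isClosed_closedBall (x := w) (ε := ρ / 2))
    ⟨_, (hF.mono hsub).restrict⟩
  have hGF : ∀ z ∈ Metric.ball w (ρ / 2), G z = F z := by
    intro z hz
    have := congrArg (fun f => f ⟨z, Metric.ball_subset_closedBall hz⟩) hG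
    simpa using this
  have h := looman_cont G.continuous (Metric.isOpen_ball (x := w) (ε := ρ / 2)) (by
    intro z hz
    obtain ⟨d, h1, h2⟩ := hd z (hsub (Metric.ball_subset_closedBall hz))
    have hev : ∀ v : ℂ, (fun t : ℝ => G (z + t * v)) =ᶠ[𝓝 0] fun t : ℝ => F (z + t * v) := by
      intro v
      have hc : ContinuousAt (fun t : ℝ => z + (t : ℂ) * v) 0 := by fun_prop
      have : ∀ᶠ t : ℝ in 𝓝 0, z + (t : ℂ) * v ∈ Metric.ball w (ρ / 2) :=
        hc.eventually (Metric.isOpen_ball.mem_nhds (by simpa using hz))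
      exact this.mono fun t ht => hGF _ ht
    exact ⟨d, h1.congr_of_eventuallyEq (hev 1), h2.congr_of_eventuallyEq (hev _)⟩)
  refine (h w (Metric.mem_ball_self (by linarith))).congr ?_
  filter_upwards [Metric.ball_mem_nhds w (half_pos hρ)] with z hz using hGF z hz

lemma xi_add (a b : ℂ) (p q : ℝ × ℝ × ℝ) : xi a b (p + q) = xi a b p + xi a b q := by
  simp only [xi, Prod.fst_add, Prod.snd_add]; push_cast; ring

lemma xi_smul (a b : ℂ) (t : ℝ) (p : ℝ × ℝ × ℝ) : xi a b (t • p) = t * xi a b p := by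
  simp only [xi, Prod.smul_fst, Prod.smul_snd, smul_eq_mul]; push_cast; ring

lemma two_sided {g : ℝ × ℝ × ℝ → ℂ} {a b d : ℂ} {p : ℝ × ℝ × ℝ}
    (H : ∀ h, Tendsto (fun ε : ℝ => (ε : ℂ)⁻¹ * (g (p + ε • h) - g p)) (𝓝[>] 0)
      (𝓝 (xi a b h * d))) (h : ℝ × ℝ × ℝ) :
    HasDerivAt (fun t : ℝ => g (p + t • h)) (xi a b h * d) 0 := by
  rw [hasDerivAt_iff_tendsto_slope]
  have hs : slope (fun t : ℝ => g (p + t • h)) 0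
      = fun ε : ℝ => (ε : ℂ)⁻¹ * (g (p + ε • h) - g p) := by
    funext ε
    simp [slope, vsub_eq_sub, Complex.real_smul]
  rw [hs, ← Set.Iio_union_Ioi, nhdsWithin_union]
  refine Tendsto.sup ?_ (H h)
  have h1 := H (-h)
  have h2 : Tendsto (fun ε : ℝ => -ε) (𝓝[<] 0) (𝓝[>] 0) := by
    have := tendsto_neg_nhdsLT (a := (0 : ℝ))
    simpa using this
  have h3 := (h1.comp h2).neg
  have h4 : xi a b (-h) = - xi a b h := by
    have := xi_smul a b (-1) h
    simpa using this
  rw [h4] at h3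
  simpa [Function.comp_def, inv_neg] using h3

lemma const_fiber {g : ℝ × ℝ × ℝ → ℂ} {a b : ℂ} {Ω : Set (ℝ × ℝ × ℝ)}
    (hc : ConvexInDirection Ω (lineL a b))
    (hd : ∀ p ∈ Ω, ∃ d : ℂ, ∀ h, HasDerivAt (fun t : ℝ => g (p + t • h)) (xi a b h * d) 0)
    {p q : ℝ × ℝ × ℝ} (hp : p ∈ Ω) (hq : q ∈ Ω) (he : xi a b p = xi a b q) : g p = g q := by
  have h0 : xi a b (q - p) = 0 := by
    have := xi_add a b (q - p) p
    rw [sub_add_cancel, he] at this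
    simpa using this.symm
  have hl : q - p ∈ lineL a b := by
    have h1 := congrArg Complex.re h0
    have h2 := congrArg Complex.im h0
    simp [xi] at h1 h2
    exact ⟨by simpa using h1, by simpa using h2⟩
  have hseg := hc p hp q hq hl
  have key : ∀ s ∈ Set.Icc (0 : ℝ) 1, HasDerivAt (fun t : ℝ => g (p + t • (q - p))) 0 s := by
    intro s hs
    have hm : p + s • (q - p) ∈ Ω := by
      apply hseg
      rw [segment_eq_image']
      exact ⟨s, hs, rfl⟩
    obtain ⟨d, hd⟩ := hd _ hm
    have h3 := hd (q - p)
    rw [h0, zero_mul] at h3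
    have h4 : HasDerivAt (fun t : ℝ => t - s) 1 s := (hasDerivAt_id s).sub_const s
    have h5 := HasDerivAt.scomp (h := fun t : ℝ => t - s) s (by simpa using h3) h4
    simp only [smul_zero] at h5
    have h6 : (fun t : ℝ => g (p + t • (q - p))) =
        (fun t : ℝ => g (p + s • (q - p) + t • (q - p))) ∘ fun t => t - s := by
      funext t
      simp only [Function.comp_apply, add_assoc, ← add_smul]
      rw [add_sub_cancel]
    rw [h6]
    exact h5
  have := constant_of_has_deriv_right_zero (f := fun t : ℝ => g (p + t • (q - p))) (a := 0) (b := 1)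
    (fun s hs => (key s hs).continuousAt.continuousWithinAt)
    (fun s hs => (key s (Set.Ico_subset_Icc_self hs)).hasDerivWithinAt) 1 (by simp)
  simpa using this.symm

lemma exists_u2 {a b : ℂ} (hab : a.im ≠ 0 ∨ b.im ≠ 0) : ∃ u, xi a b u = Complex.I := by
  rcases hab with h | h
  · refine ⟨(-a.re / a.im, 1 / a.im, 0), ?_⟩
    apply Complex.ext <;> simp [xi, -Complex.ofReal_div, -Complex.ofReal_inv, -Complex.ofReal_neg]
    · field_simp; ring
    · field_simp
  · refine ⟨(-b.re / b.im, 0, 1 / b.im), ?_⟩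
    apply Complex.ext <;> simp [xi, -Complex.ofReal_div, -Complex.ofReal_inv, -Complex.ofReal_neg]
    · field_simp; ring
    · field_simp

lemma scalar {g : ℝ × ℝ × ℝ → ℂ} {a b : ℂ} (hab : a.im ≠ 0 ∨ b.im ≠ 0) {Ω : Set (ℝ × ℝ × ℝ)}
    (hΩ : IsOpen Ω) (hc : ConvexInDirection Ω (lineL a b)) (hg : ContinuousOn g Ω)
    (H : ∀ p ∈ Ω, ∃ d : ℂ, ∀ h, Tendsto (fun ε : ℝ => (ε : ℂ)⁻¹ * (g (p + ε • h) - g p)) (𝓝[>] 0)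
      (𝓝 (xi a b h * d))) :
    ∃ F : ℂ → ℂ, AnalyticOnNhd ℂ F (xi a b '' Ω) ∧ ∀ p ∈ Ω, g p = F (xi a b p) := by
  have hd : ∀ p ∈ Ω, ∃ d : ℂ, ∀ h, HasDerivAt (fun t : ℝ => g (p + t • h)) (xi a b h * d) 0 := by
    intro p hp
    obtain ⟨d, hd⟩ := H p hp
    exact ⟨d, two_sided hd⟩
  obtain ⟨u, hu⟩ := exists_u2 hab
  have hu1 : xi a b (1, 0, 0) = 1 := by simp [xi]
  classical
  let F : ℂ → ℂ := fun w => if h : ∃ p ∈ Ω, xi a b p = w then g h.choose else 0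
  have hF : ∀ p ∈ Ω, g p = F (xi a b p) := by
    intro p hp
    have hex : ∃ q ∈ Ω, xi a b q = xi a b p := ⟨p, hp, rfl⟩
    simp only [F, dif_pos hex]
    exact const_fiber hc hd hp hex.choose_spec.1 hex.choose_spec.2.symm
  let s : ℝ × ℝ × ℝ → ℂ → ℂ → ℝ × ℝ × ℝ :=
    fun p w0 w => p + ((w - w0).re • ((1, 0, 0) : ℝ × ℝ × ℝ) + (w - w0).im • u)
  have hs : ∀ p w, xi a b (s p (xi a b p) w) = w := by
    intro p w
    simp only [s, xi_add, xi_smul, hu, hu1, mul_one]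
    rw [Complex.re_add_im]; ring
  have hsc : ∀ p w0, Continuous (s p w0) := by
    intro p w0
    have h1 : Continuous fun w : ℂ => (w - w0).re :=
      Complex.continuous_re.comp (continuous_id.sub continuous_const)
    have h2 : Continuous fun w : ℂ => (w - w0).im :=
      Complex.continuous_im.comp (continuous_id.sub continuous_const)
    exact continuous_const.add ((h1.smul continuous_const).add (h2.smul continuous_const))
  have hs0 : ∀ p, s p (xi a b p) (xi a b p) = p := by intro p; simp [s]
  have hev : ∀ p ∈ Ω, ∀ᶠ w in 𝓝 (xi a b p), s p (xi a b p) w ∈ Ω := by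
    intro p hp
    apply (hsc p (xi a b p)).continuousAt.eventually_mem
    rw [hs0]; exact hΩ.mem_nhds hp
  have hFe : ∀ p ∈ Ω, F =ᶠ[𝓝 (xi a b p)] fun w => g (s p (xi a b p) w) := by
    intro p hp
    filter_upwards [hev p hp] with w hw
    rw [hF _ hw, hs]
  refine ⟨F, looman ?_ ?_ ?_, hF⟩
  · rw [isOpen_iff_mem_nhds]
    rintro _ ⟨p, hp, rfl⟩
    filter_upwards [hev p hp] with w hw
    exact ⟨_, hw, hs p w⟩
  · rintro _ ⟨p, hp, rfl⟩
    apply ContinuousAt.continuousWithinAt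
    refine ContinuousAt.congr ?_ (hFe p hp).symm
    have : ContinuousAt g (s p (xi a b p) (xi a b p)) := by
      rw [hs0]; exact hg.continuousAt (hΩ.mem_nhds hp)
    exact ContinuousAt.comp this (hsc p _).continuousAt
  · rintro _ ⟨p, hp, rfl⟩
    obtain ⟨d, hd⟩ := hd p hp
    have hv : ∀ v : ℝ × ℝ × ℝ, HasDerivAt (fun t : ℝ => F (xi a b p + t * xi a b v))
        (xi a b v * d) 0 := by
      intro v
      refine (hd v).congr_of_eventuallyEq ?_
      have hcv : Continuous fun t : ℝ => p + t • v := by fun_prop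
      have : ∀ᶠ t : ℝ in 𝓝 0, p + t • v ∈ Ω := by
        apply hcv.continuousAt.eventually_mem
        simpa using hΩ.mem_nhds hp
      filter_upwards [this] with t ht
      rw [hF _ ht, xi_add, xi_smul]
    refine ⟨d, ?_, ?_⟩
    · simpa only [hu1] using hv (1, 0, 0)
    · simpa only [hu] using hv u

lemma continuous_coords : Continuous (fun q : HC => (q.re, q.imI, q.imJ, q.imK)) :=
  continuous_induced_dom

lemma continuous_c2 : Continuous c2 := by
  have h := continuous_coords
  unfold c2
  exact (continuous_fst.comp h).add (continuous_const.mul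
    (continuous_fst.comp (continuous_snd.comp h)))

lemma continuous_c3 : Continuous c3 := by
  have h := continuous_snd.comp (continuous_snd.comp continuous_coords)
  unfold c3
  exact (continuous_const.mul (continuous_fst.comp h)).neg.sub (continuous_snd.comp h)

lemma continuous_c4 : Continuous c4 := by
  have h := continuous_snd.comp (continuous_snd.comp continuous_coords)
  unfold c4
  exact (continuous_const.mul (continuous_fst.comp h)).neg.add (continuous_snd.comp h)

lemma continuous_zeta (i2 i3 : HC) : Continuous (zeta i2 i3) := by
  apply continuous_induced_rng.2
  simp only [Function.comp_def, zeta, QuaternionAlgebra.re_add, QuaternionAlgebra.imI_add,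
    QuaternionAlgebra.imJ_add, QuaternionAlgebra.imK_add, QuaternionAlgebra.re_smul,
    QuaternionAlgebra.imI_smul, QuaternionAlgebra.imJ_smul, QuaternionAlgebra.imK_smul, smul_eq_mul]
  fun_prop

lemma zeta_add_smul (i2 i3 : HC) (p h : ℝ × ℝ × ℝ) (t : ℝ) :
    zeta i2 i3 p + (t : ℂ) • zeta i2 i3 h = zeta i2 i3 (p + t • h) := by
  simp only [zeta, Prod.fst_add, Prod.snd_add, Prod.smul_fst, Prod.smul_snd, smul_eq_mul,
    Complex.ofReal_add, Complex.ofReal_mul]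
  module

lemma comp_scalar {i2 i3 : HC} {Φ : HC → HC} {c : HC → ℂ} (hcc : Continuous c)
    (hsub : ∀ (t : ℂ) (x y : HC), c (t • (x - y)) = t * (c x - c y))
    {a b : ℂ} (hab : a.im ≠ 0 ∨ b.im ≠ 0) {Ω : Set (ℝ × ℝ × ℝ)}
    (hΩ : IsOpen Ω) (hc : ConvexInDirection Ω (lineL a b))
    (hΦ : ContinuousOn Φ (zeta i2 i3 '' Ω)) (m : HC → HC → HC)
    (hm : ∀ h x, c (m (zeta i2 i3 h) x) = xi a b h * c x)
    (H : ∀ ζ ∈ zeta i2 i3 '' Ω, ∃ Φ' : HC, ∀ h ∈ E3 i2 i3,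
      Tendsto (fun ε : ℝ => ((ε : ℂ))⁻¹ • (Φ (ζ + (ε : ℂ) • h) - Φ ζ))
      (nhdsWithin 0 (Set.Ioi 0)) (nhds (m h Φ'))) :
    ∃ F : ℂ → ℂ, AnalyticOnNhd ℂ F (xi a b '' Ω) ∧
      ∀ p ∈ Ω, c (Φ (zeta i2 i3 p)) = F (xi a b p) := by
  refine scalar (g := fun p => c (Φ (zeta i2 i3 p))) hab hΩ hc ?_ ?_
  · exact hcc.comp_continuousOn (hΦ.comp (continuous_zeta i2 i3).continuousOn
      (fun p hp => ⟨p, hp, rfl⟩))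
  · intro p hp
    obtain ⟨Φ', h'⟩ := H _ ⟨p, hp, rfl⟩
    refine ⟨c Φ', fun h => ?_⟩
    have h2 := (hcc.tendsto _).comp (h' (zeta i2 i3 h) ⟨h, rfl⟩)
    rw [hm] at h2
    simpa only [Function.comp_def, hsub, zeta_add_smul] using h2

lemma im_ne_of_not_range {a : ℂ} (h : a ∉ Set.range ((↑) : ℝ → ℂ)) : a.im ≠ 0 :=
  fun h0 => h ⟨a.re, Complex.ext rfl (by simp [h0])⟩

lemma zeta_eq (a₁ a₂ b₁ b₂ : ℂ) (p : ℝ × ℝ × ℝ) :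
    zeta (a₁ • e1 + a₂ • e2) (b₁ • e1 + b₂ • e2) p =
      ⟨(xi a₁ b₁ p + xi a₂ b₂ p) / 2, Complex.I * (xi a₁ b₁ p - xi a₂ b₂ p) / 2, 0, 0⟩ := by
  ext <;> simp [zeta, xi, e1, e2] <;> ring

/-- Theorem 3: on a domain convex in the direction of `L₂`, every right-G-monogenic
map valued in `𝓘₁` has the form `F₁₂(ξ₂)e₂ + F₁₄(ξ₂)e₄`, and every left-G-monogenic map valued in
`𝓘̂₁` has the form `F₁₁(ξ₂)e₂ + F₁₃(ξ₂)e₃`, with the `F`'s analytic on `D₂ = f₂(Ω_ζ)`. -/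
theorem statement10 (a₁ a₂ b₁ b₂ : ℂ) (i2 i3 : HC)
    (hi2 : i2 = a₁ • e1 + a₂ • e2) (hi3 : i3 = b₁ • e1 + b₂ • e2)
    (hLI : LinIndep i2 i3)
    (Ω : Set (ℝ × ℝ × ℝ)) (hΩo : IsOpen Ω) (hΩc : IsConnected Ω)
    (hconv2 : ConvexInDirection Ω (lineL a₂ b₂))
    (hab1 : a₁ ∉ Set.range ((↑) : ℝ → ℂ) ∨ b₁ ∉ Set.range ((↑) : ℝ → ℂ))
    (hab2 : a₂ ∉ Set.range ((↑) : ℝ → ℂ) ∨ b₂ ∉ Set.range ((↑) : ℝ → ℂ)) :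
    (∀ Φ : HC → HC, RightGMonogenic i2 i3 Φ (zeta i2 i3 '' Ω) →
      (∀ ζ ∈ zeta i2 i3 '' Ω, Φ ζ ∈ I1) →
      ∃ F12 F14 : ℂ → ℂ,
        AnalyticOnNhd ℂ F12 (f2 '' (zeta i2 i3 '' Ω)) ∧
        AnalyticOnNhd ℂ F14 (f2 '' (zeta i2 i3 '' Ω)) ∧
        ∀ p ∈ Ω, Φ (zeta i2 i3 p) = F12 (xi a₂ b₂ p) • e2 + F14 (xi a₂ b₂ p) • e4) ∧
    (∀ Φh : HC → HC, LeftGMonogenic i2 i3 Φh (zeta i2 i3 '' Ω) →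
      (∀ ζ ∈ zeta i2 i3 '' Ω, Φh ζ ∈ Ih1) →
      ∃ F11 F13 : ℂ → ℂ,
        AnalyticOnNhd ℂ F11 (f2 '' (zeta i2 i3 '' Ω)) ∧
        AnalyticOnNhd ℂ F13 (f2 '' (zeta i2 i3 '' Ω)) ∧
        ∀ p ∈ Ω, Φh (zeta i2 i3 p) = F11 (xi a₂ b₂ p) • e2 + F13 (xi a₂ b₂ p) • e3) := by
  subst hi2 hi3
  have hab : a₂.im ≠ 0 ∨ b₂.im ≠ 0 := hab2.imp im_ne_of_not_range im_ne_of_not_range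
  have hD : f2 '' (zeta (a₁ • e1 + a₂ • e2) (b₁ • e1 + b₂ • e2) '' Ω) = xi a₂ b₂ '' Ω := by
    rw [Set.image_image]
    refine Set.image_congr fun p _ => ?_
    rw [zeta_eq]
    simp only [f2, c2, c4]
    linear_combination (xi a₁ b₁ p - xi a₂ b₂ p) / 2 * Complex.I_mul_I
  rw [hD]
  have hI := Complex.I_mul_I
  constructor
  · intro Φ hΦ hv
    obtain ⟨F, hF, hF'⟩ := comp_scalar continuous_c2
      (by intro t x y; simp [c2]; ring) hab hΩo hconv2 hΦ.1 (fun h x => h * x)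
      (by
        intro h x
        rw [zeta_eq]
        simp [c2]
        ring_nf
        simp
        ring) hΦ.2
    obtain ⟨G, hG, hG'⟩ := comp_scalar continuous_c4
      (by intro t x y; simp [c4]; ring) hab hΩo hconv2 hΦ.1 (fun h x => h * x)
      (by
        intro h x
        rw [zeta_eq]
        simp [c4]
        ring_nf
        simp
        ring) hΦ.2
    refine ⟨F, G, hF, hG, fun p hp => ?_⟩
    rw [← hF' p hp, ← hG' p hp]
    obtain ⟨l2, l4, hl⟩ := hv _ ⟨p, hp, rfl⟩
    rw [hl]
    have h2 : c2 (l2 • e2 + l4 • e4) = l2 := by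
      simp [c2, e2, e4]; linear_combination -l2 / 2 * hI
    have h4 : c4 (l2 • e2 + l4 • e4) = l4 := by
      simp [c4, e2, e4]; linear_combination -l4 / 2 * hI
    rw [h2, h4]
  · intro Φ hΦ hv
    obtain ⟨F, hF, hF'⟩ := comp_scalar continuous_c2
      (by intro t x y; simp [c2]; ring) hab hΩo hconv2 hΦ.1 (fun h x => x * h)
      (by
        intro h x
        rw [zeta_eq]
        simp [c2]
        ring_nf
        simp
        ring) hΦ.2
    obtain ⟨G, hG, hG'⟩ := comp_scalar continuous_c3
      (by intro t x y; simp [c3]; ring) hab hΩo hconv2 hΦ.1 (fun h x => x * h)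
      (by
        intro h x
        rw [zeta_eq]
        simp [c3]
        ring_nf
        simp
        ring) hΦ.2
    refine ⟨F, G, hF, hG, fun p hp => ?_⟩
    rw [← hF' p hp, ← hG' p hp]
    obtain ⟨l2, l3, hl⟩ := hv _ ⟨p, hp, rfl⟩
    rw [hl]
    have h2 : c2 (l2 • e2 + l3 • e3) = l2 := by
      simp [c2, e2, e3]; linear_combination -l2 / 2 * hI
    have h3 : c3 (l2 • e2 + l3 • e3) = l3 := by
      simp [c3, e2, e3]; linear_combination -l3 / 2 * hI
    rw [h2, h3]

end
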